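/- Let r ≥ 1, let f(x) ∈ ℚ[x] be an irreducible polynomial of degree d with d > r and d ≥ 2, and let b be a nonzero integer. Then the equation b·n₁‼ ⋯ n_r‼ = f(x) has only finitely many solutions (n₁, …, n_r, x) with each n_i a natural number and x an integer. -/

import Mathlib

open NumberField Polynomial

/-- counting nonzero ideals -/
noncomputable def idealCount (K : Type*) [Field K] [NumberField K] (n : ℕ) : ℕ :=
  {I : Ideal (𝓞 K) | I ≠ ⊥ ∧ Ideal.absNorm I ≤ n}.ncard

theorem idealSet_finite (K : Type*) [Field K] [NumberField K] (n : ℕ) :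
    {I : Ideal (𝓞 K) | I ≠ ⊥ ∧ Ideal.absNorm I ≤ n}.Finite :=
  (Ideal.finite_setOfPred_absNorm_le n).subset fun _ h => h.2

theorem idealCount_eq (K : Type*) [Field K] [NumberField K] (n : ℕ) :
    Nat.card {I : Ideal (𝓞 K) // Ideal.absNorm I ≤ n} = idealCount K n + 1 := by
  have h : {I : Ideal (𝓞 K) | Ideal.absNorm I ≤ n} =
      insert ⊥ {I : Ideal (𝓞 K) | I ≠ ⊥ ∧ Ideal.absNorm I ≤ n} := by
    ext I
    by_cases hI : I = ⊥ <;> simp [hI]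
  have h2 := Set.ncard_insert_of_notMem (a := (⊥ : Ideal (𝓞 K)))
    (s := {I : Ideal (𝓞 K) | I ≠ ⊥ ∧ Ideal.absNorm I ≤ n}) (by simp) (idealSet_finite K n)
  rw [← h] at h2
  exact h2

theorem idealCount_bounds (K : Type*) [Field K] [NumberField K] :
    ∃ κ C : ℝ, 0 < κ ∧ 0 < C ∧ (∀ n : ℕ, (idealCount K n : ℝ) ≤ C * n) ∧
      ∃ N : ℕ, ∀ n ≥ N, κ * n ≤ idealCount K n := by
  have h := (Ideal.tendsto_norm_le_div_atTop K).comp (tendsto_natCast_atTop_atTop (R := ℝ))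
  rw [← NumberField.dedekindZeta_residue_def] at h
  have hpos := NumberField.dedekindZeta_residue_pos K
  set ρ := NumberField.dedekindZeta_residue K
  have h' : Filter.Tendsto (fun n : ℕ => (idealCount K n : ℝ) / n) Filter.atTop (nhds ρ) := by
    have h1 : Filter.Tendsto (fun n : ℕ => (1 : ℝ) / n) Filter.atTop (nhds 0) :=
      tendsto_one_div_atTop_nhds_zero_nat
    have h2 := h.sub h1
    rw [sub_zero] at h2
    refine h2.congr fun n => ?_
    have := idealCount_eq K n
    simp only [Function.comp, Nat.cast_le]
    rw [this]; push_cast; ring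
  obtain ⟨C, hC⟩ := h'.bddAbove_range
  have h3 := h'.eventually (lt_mem_nhds (show ρ / 2 < ρ by linarith))
  obtain ⟨N, hN⟩ := Filter.eventually_atTop.1 h3
  refine ⟨ρ / 2, max C 1, by positivity, by positivity, fun n => ?_, N + 1, fun n hn => ?_⟩
  · rcases Nat.eq_zero_or_pos n with rfl | hn
    · have : idealCount K 0 = 0 := by
        unfold idealCount
        rw [Set.ncard_eq_zero (idealSet_finite K 0)]
        ext I; simp [Ideal.absNorm_eq_zero_iff]
      simp [this]
    · have := hC ⟨n, rfl⟩
      have hn' : (0 : ℝ) < n := by exact_mod_cast hn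
      have h4 : (idealCount K n : ℝ) / n ≤ max C 1 := this.trans (le_max_left _ _)
      rwa [div_le_iff₀ hn'] at h4
  · have := hN n (by omega)
    have hn' : (0 : ℝ) < n := by exact_mod_cast (by omega : 0 < n)
    rw [lt_div_iff₀ hn'] at this
    exact this.le

theorem primeIdeal_of_absNorm {K : Type*} [Field K] [NumberField K] {P : Ideal (𝓞 K)} {p : ℕ}
    (hp : p.Prime) (h : Ideal.absNorm P = p) : Prime P :=
  (Ideal.irreducible_of_irreducible_absNorm (I := P) (by rw [h]; exact hp)).prime


theorem primeIdeal_norm {K : Type*} [Field K] [NumberField K] {P : Ideal (𝓞 K)} (hP : Prime P)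
    {p : ℕ} (hp : p.Prime) (hpP : (p : 𝓞 K) ∈ P) : ∃ k, 0 < k ∧ Ideal.absNorm P = p ^ k := by
  have hPp := Ideal.isPrime_of_prime hP
  have hmax : P.IsMaximal := hPp.isMaximal hP.ne_zero
  obtain ⟨q, n, hn, hqP, hq, h⟩ := Ideal.exists_prime_and_absNorm_eq_pow P
  suffices p = q by subst this; exact ⟨n, hn, h⟩
  by_contra hne
  have hc : IsCoprime (p : ℤ) (q : ℤ) := Nat.isCoprime_iff_coprime.2 ((Nat.coprime_primes hp hq).2 hne)
  obtain ⟨a, b, hab⟩ := hc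
  have h1 : (1 : 𝓞 K) ∈ P := by
    have : (1 : 𝓞 K) = a * p + b * q := by exact_mod_cast (congrArg (Int.cast : ℤ → 𝓞 K) hab).symm
    rw [this]
    exact P.add_mem (P.mul_mem_left _ hpP) (P.mul_mem_left _ hqP)
  exact hPp.ne_top ((Ideal.eq_top_iff_one P).2 h1)

theorem primesContaining_finite {K : Type*} [Field K] [NumberField K] {p : ℕ} (hp : p.Prime) :
    {P : Ideal (𝓞 K) | Prime P ∧ (p : 𝓞 K) ∈ P}.Finite := by
  refine (Ideal.finite_setOfPred_absNorm_le (p ^ Module.finrank ℤ (𝓞 K))).subset ?_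
  rintro P ⟨-, h⟩
  rw [← Ideal.span_singleton_le_iff_mem] at h
  have := Ideal.absNorm_dvd_absNorm_of_le h
  rw [Ideal.absNorm_span_natCast] at this
  exact Nat.le_of_dvd (pow_pos hp.pos _) this

theorem primesOver_card {K : Type*} [Field K] [NumberField K] {p : ℕ} (hp : p.Prime)
    (F : Finset (Ideal (𝓞 K))) (hF : ∀ P ∈ F, Prime P ∧ (p : 𝓞 K) ∈ P) :
    F.card ≤ Module.finrank ℤ (𝓞 K) := by
  have h1 : ∏ P ∈ F, P ∣ Ideal.span {(p : 𝓞 K)} :=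
    Finset.prod_primes_dvd _ (fun P hP => (hF P hP).1) fun P hP => by
      rw [Ideal.dvd_span_singleton]; exact (hF P hP).2
  have h2 := Ideal.absNorm_dvd_absNorm_of_le (Ideal.le_of_dvd h1)
  rw [Ideal.absNorm_span_natCast, map_prod] at h2
  have h3 : p ^ F.card ∣ ∏ P ∈ F, Ideal.absNorm P := by
    rw [← Finset.prod_const]
    refine Finset.prod_dvd_prod_of_dvd _ _ fun P hP => ?_
    obtain ⟨k, hk, h⟩ := primeIdeal_norm (hF P hP).1 hp (hF P hP).2
    rw [h]; exact dvd_pow_self _ hk.ne'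
  exact (Nat.pow_dvd_pow_iff_le_right hp.one_lt).1 (h3.trans h2)

theorem smooth_repr {K : Type*} [Field K] [NumberField K] (F : Finset (Ideal (𝓞 K)))
    (I : Ideal (𝓞 K)) (hI : I ≠ ⊥) (h : ∀ P, Prime P → P ∣ I → P ∈ F) :
    ∃ e : F → ℕ, I = ∏ P : F, (P : Ideal (𝓞 K)) ^ e P := by
  classical
  induction I using UniqueFactorizationMonoid.induction_on_prime with
  | h₁ => exact absurd rfl hI
  | h₂ I hu => exact ⟨0, by simpa [← Ideal.one_eq_top] using hu⟩
  | h₃ I P hI' hP ih =>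
    obtain ⟨e, he⟩ := ih hI' fun Q hQ hd => h Q hQ (hd.mul_left _)
    refine ⟨e + Pi.single ⟨P, h P hP (dvd_mul_right _ _)⟩ 1, ?_⟩
    simp only [Pi.add_apply, pow_add, Finset.prod_mul_distrib, ← he]
    rw [Finset.prod_eq_single ⟨P, h P hP (dvd_mul_right _ _)⟩]
    · simp [mul_comm]
    · intro Q _ hQ
      simp [Pi.single_eq_of_ne hQ]
    · simp

theorem smooth_card {K : Type*} [Field K] [NumberField K] (F : Finset (Ideal (𝓞 K))) (j : ℕ)
    (hFp : ∀ P ∈ F, Prime P)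
    (A : Finset (Ideal (𝓞 K))) (hA : ∀ I ∈ A, I ≠ ⊥ ∧ Ideal.absNorm I ≤ 2 ^ j ∧
      ∀ P, Prime P → P ∣ I → P ∈ F) : A.card ≤ (j + 1) ^ F.card := by
  classical
  have hsub : A ⊆ (Fintype.piFinset fun _ : F => Finset.range (j + 1)).image
      fun e => ∏ P : F, (P : Ideal (𝓞 K)) ^ e P := by
    intro I hI
    obtain ⟨h0, hn, hs⟩ := hA I hI
    obtain ⟨e, he⟩ := smooth_repr F I h0 hs
    refine Finset.mem_image.2 ⟨e, ?_, he.symm⟩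
    rw [Fintype.mem_piFinset]
    intro P
    rw [Finset.mem_range, Nat.lt_succ_iff]
    have h1 : (P : Ideal (𝓞 K)) ^ e P ∣ I := he ▸ Finset.dvd_prod_of_mem _ (Finset.mem_univ P)
    have h2 := Ideal.absNorm_dvd_absNorm_of_le (Ideal.le_of_dvd h1)
    have hpos : 0 < Ideal.absNorm I :=
      Nat.pos_of_ne_zero fun h => h0 (Ideal.absNorm_eq_zero_iff.1 h)
    have h3 := (Nat.le_of_dvd hpos h2).trans hn
    rw [map_pow] at h3
    have h4 : 2 ≤ Ideal.absNorm (P : Ideal (𝓞 K)) := by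
      have hp := hFp P P.2
      have a1 : Ideal.absNorm (P : Ideal (𝓞 K)) ≠ 0 := fun h => hp.ne_zero (Ideal.absNorm_eq_zero_iff.1 h)
      have a2 : Ideal.absNorm (P : Ideal (𝓞 K)) ≠ 1 := fun h =>
        hp.not_isUnit (by rw [Ideal.isUnit_iff]; exact Ideal.absNorm_eq_one_iff.1 h)
      omega
    have h5 : 2 ^ e P ≤ 2 ^ j := (Nat.pow_le_pow_left h4 _).trans h3
    exact (Nat.pow_le_pow_iff_right (by norm_num)).1 h5
  refine (Finset.card_le_card hsub).trans (Finset.card_image_le.trans ?_)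
  simp [Fintype.card_piFinset]

theorem lemma1 (K : Type*) [Field K] [NumberField K] (B : ℕ) (S : Set ℕ)
    (hS : ∀ p, p.Prime → B < p → ∀ P : Ideal (𝓞 K), Ideal.absNorm P = p → p ∈ S) :
    ¬ Summable (S.indicator fun p : ℕ => (1 : ℝ) / p) := by
  classical
  intro hsum
  obtain ⟨κ, C, hκ, hC0, hC, N, hN⟩ := idealCount_bounds K
  set m := Module.finrank ℤ (𝓞 K)
  set g : ℕ → ℝ := fun p => S.indicator (fun p : ℕ => (1 : ℝ) / p) p +
    (if p ≤ B then (1 : ℝ) / p else 0) + 1 / (p : ℝ) ^ 2 with hg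
  have hgs : Summable g := by
    refine (hsum.add ?_).add (Real.summable_one_div_nat_pow.2 (by norm_num))
    refine summable_of_ne_finset_zero (s := Finset.range (B + 1)) fun p hp => ?_
    rw [if_neg]; simpa [Nat.lt_succ_iff] using hp
  have hgle : ∀ p : ℕ, p.Prime → ∀ P : Ideal (𝓞 K), Prime P → (p : 𝓞 K) ∈ P →
      1 / (Ideal.absNorm P : ℝ) ≤ g p := by
    intro p hp P hP hpP
    obtain ⟨k, hk, h⟩ := primeIdeal_norm hP hp hpP
    have n1 : 0 ≤ S.indicator (fun p : ℕ => (1 : ℝ) / p) p :=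
      Set.indicator_nonneg (by intros; positivity) p
    have n2 : (0 : ℝ) ≤ if p ≤ B then (1 : ℝ) / p else 0 := by split_ifs <;> positivity
    have n3 : (0 : ℝ) ≤ 1 / (p : ℝ) ^ 2 := by positivity
    have hp1 : (1 : ℝ) ≤ p := by exact_mod_cast hp.one_lt.le
    simp only [hg]
    rcases (by omega : k = 1 ∨ 2 ≤ k) with rfl | hk2
    · rw [pow_one] at h
      rw [h]
      by_cases hB : p ≤ B
      · rw [if_pos hB] at n2 ⊢; linarith
      · have hpS : p ∈ S := hS p hp (by omega) P h
        rw [Set.indicator_of_mem hpS] at n1 ⊢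
        linarith
    · have : 1 / (Ideal.absNorm P : ℝ) ≤ 1 / (p : ℝ) ^ 2 := by
        rw [h]; push_cast
        apply one_div_le_one_div_of_le (by positivity)
        exact pow_le_pow_right₀ hp1 hk2
      linarith
  set ε := κ / (2 * (m * C + 1)) with hε
  have hεpos : 0 < ε := by positivity
  obtain ⟨s, hs⟩ := summable_iff_vanishing_norm.1 hgs ε hεpos
  set Y := s.sup id + 1 with hY
  let G : ℕ → Finset (Ideal (𝓞 K)) := fun p =>
    if hp : p.Prime then (primesContaining_finite (K := K) hp).toFinset else ∅
  have hG : ∀ p : ℕ, p.Prime → ∀ P, P ∈ G p ↔ Prime P ∧ (p : 𝓞 K) ∈ P := by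
    intro p hp P; simp [G, hp]
  set F : Finset (Ideal (𝓞 K)) := ((Finset.range Y).filter Nat.Prime).biUnion G with hF
  let Z : ℕ → Finset (Ideal (𝓞 K)) := fun n => (idealSet_finite K n).toFinset
  have hZ : ∀ n I, I ∈ Z n ↔ I ≠ ⊥ ∧ Ideal.absNorm I ≤ n := by intro n I; simp [Z]
  have hZc : ∀ n, (Z n).card = idealCount K n := fun n =>
    (Set.ncard_eq_toFinset_card _ _).symm
  have main : ∀ j : ℕ, N ≤ 2 ^ j → κ / 2 * 2 ^ j ≤ ((j : ℝ) + 1) ^ F.card := by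
    intro j hj
    set X := 2 ^ j with hX
    set T := (Finset.range (X + 1)).filter fun p => p.Prime ∧ Y ≤ p with hT
    set A := (Z X).filter fun I => ∀ P, Prime P → P ∣ I → P ∈ F with hA
    have hcover : Z X ⊆ A ∪ T.biUnion fun p => (G p).biUnion fun P =>
        (Z (X / Ideal.absNorm P)).image (P * ·) := by
      intro I hI
      obtain ⟨h0, hn⟩ := (hZ _ _).1 hI
      have hpos : 0 < Ideal.absNorm I :=
        Nat.pos_of_ne_zero fun h => h0 (Ideal.absNorm_eq_zero_iff.1 h)
      rw [Finset.mem_union]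
      by_cases hex : ∃ p, p.Prime ∧ Y ≤ p ∧ p ∣ Ideal.absNorm I
      · right
        obtain ⟨p, hp, hYp, hd⟩ := hex
        obtain ⟨P, hPm, hPu, J, rfl⟩ := Ideal.exists_isMaximal_dvd_of_dvd_absNorm' hp I hd
        have hP0 : P ≠ ⊥ := fun h => h0 (by rw [h]; simp)
        have hJ0 : J ≠ ⊥ := fun h => h0 (by rw [h]; simp)
        have hPp : Prime P := Ideal.prime_of_isPrime hP0 hPm.isPrime
        have hpP : (p : 𝓞 K) ∈ P := by
          have : (p : ℤ) ∈ P.under ℤ := by rw [hPu]; exact Ideal.mem_span_singleton_self _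
          simpa [Ideal.under_def, Ideal.mem_comap] using this
        have hPpos : 0 < Ideal.absNorm P :=
          Nat.pos_of_ne_zero fun h => hP0 (Ideal.absNorm_eq_zero_iff.1 h)
        simp only [Finset.mem_biUnion]
        refine ⟨p, ?_, P, (hG p hp P).2 ⟨hPp, hpP⟩, Finset.mem_image.2 ⟨J, ?_, rfl⟩⟩
        · rw [hT, Finset.mem_filter, Finset.mem_range]
          exact ⟨Nat.lt_succ_of_le ((Nat.le_of_dvd hpos hd).trans hn), hp, hYp⟩
        · rw [hZ]
          refine ⟨hJ0, ?_⟩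
          rw [Nat.le_div_iff_mul_le hPpos, mul_comm, ← map_mul]
          exact hn
      · left
        rw [hA, Finset.mem_filter]
        refine ⟨hI, fun P hP hd => ?_⟩
        have hPm : P.IsMaximal := (Ideal.isPrime_of_prime hP).isMaximal hP.ne_zero
        obtain ⟨q, n, hn, hqP, hq, h⟩ := Ideal.exists_prime_and_absNorm_eq_pow P
        have hqd : q ∣ Ideal.absNorm I :=
          ((dvd_pow_self q hn.ne').trans h.symm.dvd).trans
            (Ideal.absNorm_dvd_absNorm_of_le (Ideal.le_of_dvd hd))
        have hqY : q < Y := by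
          by_contra hlt
          exact hex ⟨q, hq, by omega, hqd⟩
        rw [hF, Finset.mem_biUnion]
        exact ⟨q, by simp [hq, hqY], (hG q hq P).2 ⟨hP, hqP⟩⟩
    have hAcard : A.card ≤ (j + 1) ^ F.card := by
      refine smooth_card F j ?_ A ?_
      · intro P hP
        rw [hF, Finset.mem_biUnion] at hP
        obtain ⟨q, hq, hPq⟩ := hP
        exact ((hG q (Finset.mem_filter.1 hq).2 P).1 hPq).1
      · intro I hI
        rw [hA, Finset.mem_filter, hZ] at hI
        exact ⟨hI.1.1, hI.1.2, hI.2⟩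
    have hTs : ∑ p ∈ T, g p ≤ ε := by
      have := hs T ?_
      · exact (le_abs_self _).trans this.le
      · rw [Finset.disjoint_left]
        intro p hp hps
        have h1 : p ≤ s.sup id := Finset.le_sup (f := id) hps
        have h2 := (Finset.mem_filter.1 hp).2.2
        omega
    have hbig : ((T.biUnion fun p => (G p).biUnion fun P =>
        (Z (X / Ideal.absNorm P)).image (P * ·)).card : ℝ) ≤ ε * (m * C * X) := by
      calc _ ≤ ∑ p ∈ T, ∑ P ∈ G p, (idealCount K (X / Ideal.absNorm P) : ℝ) := by
            have : (T.biUnion fun p => (G p).biUnion fun P =>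
              (Z (X / Ideal.absNorm P)).image (P * ·)).card ≤
                ∑ p ∈ T, ∑ P ∈ G p, idealCount K (X / Ideal.absNorm P) := by
              refine Finset.card_biUnion_le.trans (Finset.sum_le_sum fun p _ => ?_)
              refine Finset.card_biUnion_le.trans (Finset.sum_le_sum fun P _ => ?_)
              exact Finset.card_image_le.trans (hZc _).le
            exact_mod_cast this
        _ ≤ ∑ p ∈ T, g p * (m * C * X) := by
            refine Finset.sum_le_sum fun p hpT => ?_
            have hp := (Finset.mem_filter.1 hpT).2.1
            have hg0 : 0 ≤ g p := by
              have n1 : 0 ≤ S.indicator (fun p : ℕ => (1 : ℝ) / p) p :=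
                Set.indicator_nonneg (by intros; positivity) p
              simp only [hg]
              split_ifs <;> positivity
            calc _ ≤ ∑ P ∈ G p, g p * (C * X) := by
                  refine Finset.sum_le_sum fun P hP => ?_
                  obtain ⟨hPp, hpP⟩ := (hG p hp P).1 hP
                  have h1 := hgle p hp P hPp hpP
                  calc (idealCount K (X / Ideal.absNorm P) : ℝ) ≤ C * (X / Ideal.absNorm P : ℕ) := hC _
                    _ ≤ C * ((X : ℝ) / Ideal.absNorm P) := by
                        gcongr; exact Nat.cast_div_le
                    _ = (1 / (Ideal.absNorm P : ℝ)) * (C * X) := by ring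
                    _ ≤ g p * (C * X) := by gcongr
              _ = (G p).card * (g p * (C * X)) := by rw [Finset.sum_const, nsmul_eq_mul]
              _ ≤ m * (g p * (C * X)) := by
                  have : (G p).card ≤ m := primesOver_card hp _ fun P hP => (hG p hp P).1 hP
                  gcongr
              _ = g p * (m * C * X) := by ring
        _ = (∑ p ∈ T, g p) * (m * C * X) := by rw [Finset.sum_mul]
        _ ≤ ε * (m * C * X) := by gcongr
    have h1 : (idealCount K X : ℝ) ≤ ((j : ℝ) + 1) ^ F.card + ε * (m * C * X) := by
      have a1 := (Finset.card_le_card hcover).trans (Finset.card_union_le _ _)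
      rw [hZc] at a1
      have a2 := (Nat.cast_le (α := ℝ)).2 a1
      rw [Nat.cast_add] at a2
      have a3 : (A.card : ℝ) ≤ ((j : ℝ) + 1) ^ F.card := by exact_mod_cast hAcard
      linarith
    have h2 := hN X hj
    have h3 : ε * (m * C) ≤ κ / 2 := by
      rw [hε, div_mul_eq_mul_div, div_le_div_iff₀ (by positivity) (by norm_num)]
      nlinarith
    have hXr : (X : ℝ) = 2 ^ j := by rw [hX]; push_cast; rfl
    have h4 : ε * (m * C * X) ≤ κ / 2 * X := by
      rw [← mul_assoc]; gcongr
    rw [← hXr]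
    linarith
  have hlim := (tendsto_pow_const_div_const_pow_of_one_lt F.card (r := (2 : ℝ)) (by norm_num)).comp
    (Filter.tendsto_add_atTop_nat 1)
  have hev := hlim.eventually (gt_mem_nhds (show (0 : ℝ) < κ / 4 by positivity))
  obtain ⟨J, hJ⟩ := Filter.eventually_atTop.1 hev
  have h1 := hJ (max J N) (le_max_left _ _)
  have h2 := main (max J N) ((le_max_right J N).trans Nat.lt_two_pow_self.le)
  simp only [Function.comp] at h1
  rw [div_lt_iff₀ (by positivity)] at h1
  push_cast at h1 h2
  rw [pow_succ] at h1
  linarith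

/-- ideal attached to an integer from a choice of primes -/
noncomputable def prodIdeal {K : Type*} [Field K] [NumberField K] (P : ℕ → Ideal (𝓞 K)) (m : ℕ) :
    Ideal (𝓞 K) := (m.primeFactorsList.map P).prod

theorem absNorm_prodIdeal {K : Type*} [Field K] [NumberField K] (P : ℕ → Ideal (𝓞 K)) (m : ℕ)
    (hm : m ≠ 0) (h : ∀ q, q.Prime → q ∣ m → Ideal.absNorm (P q) = q) :
    Ideal.absNorm (prodIdeal P m) = m := by
  unfold prodIdeal
  rw [map_list_prod, List.map_map]
  conv_rhs => rw [← Nat.prod_primeFactorsList hm]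
  congr 1
  conv_rhs => rw [← List.map_id m.primeFactorsList]
  apply List.map_congr_left
  intro q hq
  exact h q (Nat.prime_of_mem_primeFactorsList hq) (Nat.dvd_of_mem_primeFactorsList hq)

theorem lemma2 (K : Type*) [Field K] [NumberField K] (B : ℕ) (P Q : ℕ → Ideal (𝓞 K)) (S : Set ℕ)
    (hP : ∀ q, q.Prime → B < q → Ideal.absNorm (P q) = q)
    (hS : ∀ p ∈ S, p.Prime ∧ B < p ∧ Ideal.absNorm (Q p) = p ∧ Q p ≠ P p) :
    Summable (S.indicator fun p : ℕ => (1 : ℝ) / p) := by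
  obtain ⟨κ, C, -, hC0, hC, -⟩ := idealCount_bounds K
  set M := B.factorial with hM
  have hMpos : 0 < M := B.factorial_pos
  have hgood : ∀ k q, q.Prime → q ∣ 1 + M * k → B < q := by
    intro k q hq hd
    by_contra hle
    have h1 : q ∣ M := Nat.dvd_factorial hq.pos (by omega)
    have h2 : q ∣ 1 := (Nat.dvd_add_left (h1.mul_right k)).1 hd
    exact hq.one_lt.ne' (Nat.dvd_one.1 h2)
  have hnorm : ∀ k, Ideal.absNorm (prodIdeal P (1 + M * k)) = 1 + M * k := fun k =>
    absNorm_prodIdeal P _ (by omega) fun q hq hd => hP q hq (hgood k q hq hd)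
  have key : ∀ T : Finset ℕ, (∀ p ∈ T, p ∈ S) → ∑ p ∈ T, (1 : ℝ) / p ≤ C * M := by
    intro T hT
    set D := ∏ p ∈ T, p with hD
    have hDpos : 0 < D := Finset.prod_pos fun p hp => (hS p (hT p hp)).1.pos
    have hDd : ∀ p ∈ T, p ∣ D := fun p hp => Finset.dvd_prod_of_mem _ hp
    set E : Finset (Σ _ : ℕ, ℕ) := T.sigma fun p => Finset.range (D / p) with hE
    have hcard : E.card ≤ idealCount K (M * D) := by
      rw [← Set.ncard_coe_finset]
      refine Set.ncard_le_ncard_of_injOn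
        (fun x => Q x.1 * prodIdeal P (1 + M * x.2)) ?_ ?_ (idealSet_finite K _)
      · rintro ⟨p, k⟩ hx
        simp only [hE, Finset.coe_sigma, Set.mem_sigma_iff, Finset.mem_coe, Finset.mem_range] at hx
        obtain ⟨hp, hk⟩ := hx
        have hn : Ideal.absNorm (Q p * prodIdeal P (1 + M * k)) = p * (1 + M * k) := by
          rw [map_mul, hnorm, (hS p (hT p hp)).2.2.1]
        have hppos := (hS p (hT p hp)).1.pos
        refine ⟨?_, ?_⟩
        · intro h0
          have h0' : Q p * prodIdeal P (1 + M * k) = ⊥ := h0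
          rw [h0', Ideal.absNorm_bot] at hn
          have : 0 < p * (1 + M * k) := by positivity
          omega
        · change Ideal.absNorm (Q p * prodIdeal P (1 + M * k)) ≤ M * D
          rw [hn]
          have h1 : p * (k + 1) ≤ D := by
            calc p * (k + 1) ≤ p * (D / p) := Nat.mul_le_mul_left _ hk
              _ ≤ D := Nat.mul_div_le _ _
          calc p * (1 + M * k) ≤ p * (M * (k + 1)) := by
                apply Nat.mul_le_mul_left; nlinarith
            _ = M * (p * (k + 1)) := by ring
            _ ≤ M * D := Nat.mul_le_mul_left _ h1
      · rintro ⟨p, k⟩ hx ⟨p', k'⟩ hx' heq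
        simp only [hE, Finset.coe_sigma, Set.mem_sigma_iff, Finset.mem_coe, Finset.mem_range]
          at hx hx'
        have hp := hS p (hT p hx.1)
        have hp' := hS p' (hT p' hx'.1)
        simp only at heq
        have hpp : p = p' := by
          have hprime := primeIdeal_of_absNorm hp.1 hp.2.2.1
          have hd : Q p ∣ Q p' * prodIdeal P (1 + M * k') := heq ▸ dvd_mul_right _ _
          rcases hprime.dvd_or_dvd hd with h | h
          · rw [hprime.dvd_prime_iff_associated (primeIdeal_of_absNorm hp'.1 hp'.2.2.1),
              associated_iff_eq] at h
            rw [← hp.2.2.1, h, hp'.2.2.1]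
          · exfalso
            unfold prodIdeal at h
            rw [hprime.dvd_prod_iff] at h
            obtain ⟨J, hJ, hdJ⟩ := h
            obtain ⟨q, hq, rfl⟩ := List.mem_map.1 hJ
            have hqp := Nat.prime_of_mem_primeFactorsList hq
            have hPq := hP q hqp (hgood k' q hqp (Nat.dvd_of_mem_primeFactorsList hq))
            rw [hprime.dvd_prime_iff_associated (primeIdeal_of_absNorm hqp hPq),
              associated_iff_eq] at hdJ
            have : p = q := by rw [← hp.2.2.1, hdJ, hPq]
            exact hp.2.2.2 (this ▸ hdJ)
        subst hpp
        have hn := congrArg Ideal.absNorm heq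
        rw [map_mul, map_mul, hnorm, hnorm, hp.2.2.1] at hn
        have h1 := Nat.eq_of_mul_eq_mul_left hp.1.pos hn
        have h2 : k = k' := Nat.eq_of_mul_eq_mul_left hMpos (by omega)
        rw [h2]
    have hcard2 : (E.card : ℝ) = D * ∑ p ∈ T, (1 : ℝ) / p := by
      rw [hE, Finset.card_sigma, Finset.mul_sum]
      push_cast
      refine Finset.sum_congr rfl fun p hp => ?_
      rw [Finset.card_range, Nat.cast_div (hDd p hp)
        (by exact_mod_cast (hS p (hT p hp)).1.ne_zero)]
      ring
    have h1 : (E.card : ℝ) ≤ C * (M * D : ℕ) :=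
      le_trans (by exact_mod_cast hcard) (hC (M * D))
    rw [hcard2] at h1
    have hD' : (0 : ℝ) < D := by exact_mod_cast hDpos
    push_cast at h1
    have h2 : (D : ℝ) * ∑ p ∈ T, (1 : ℝ) / p ≤ D * (C * M) := by linarith
    exact le_of_mul_le_mul_left h2 hD'
  classical
  refine summable_of_sum_le (c := C * M) (fun p => Set.indicator_nonneg (by intros; positivity) p)
    fun u => ?_
  have := key (u.filter (· ∈ S)) (by simp)
  rw [Finset.sum_filter] at this
  refine le_trans (le_of_eq ?_) this
  refine Finset.sum_congr rfl fun p _ => ?_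
  simp [Set.indicator_apply]


theorem exponent_ne_zero_aux {K : Type*} [Field K] [NumberField K] (θ : 𝓞 K)
    (h : Algebra.adjoin ℚ {(θ : K)} = ⊤) : RingOfIntegers.exponent θ ≠ 0 := by
  have hIntg : IsIntegral ℚ (θ : K) := (θ.isIntegral_coe).tower_top
  let B : PowerBasis ℚ K := (Algebra.adjoin.powerBasis hIntg).map
    ((Subalgebra.equivOfEq _ _ h).trans Subalgebra.topEquiv)
  have hgen : B.gen = (θ : K) := by
    simp [B, PowerBasis.map, Algebra.adjoin.powerBasis]
  have hBint : IsIntegral ℤ B.gen := by rw [hgen]; exact θ.isIntegral_coe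
  have hdint : IsIntegral ℤ (Algebra.discr ℚ B.basis) :=
    Algebra.discr_isIntegral ℚ (fun i => by rw [B.basis_eq_pow]; exact hBint.pow _)
  obtain ⟨D, hD⟩ := IsIntegrallyClosed.isIntegral_iff.1 hdint
  have hD0 : D ≠ 0 := by
    rintro rfl
    have := Algebra.discr_not_zero_of_basis ℚ B.basis
    rw [map_zero] at hD
    exact this hD.symm
  intro h0
  unfold RingOfIntegers.exponent at h0
  rw [Ideal.absNorm_eq_zero_iff] at h0
  have hmem : D ∈ Ideal.under ℤ (conductor ℤ θ) := by
    rw [Ideal.under_def, Ideal.mem_comap, mem_conductor_iff]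
    intro b
    have h1 := Algebra.discr_mul_isIntegral_mem_adjoin (R := ℤ) ℚ (B := B) hBint
      (z := (b : K)) b.isIntegral_coe
    rw [hgen] at h1
    have h2 : (Algebra.adjoin ℤ {(θ : K)}) =
        (Algebra.adjoin ℤ {θ}).map (IsScalarTower.toAlgHom ℤ (𝓞 K) K) := by
      rw [AlgHom.map_adjoin]; simp
    rw [h2] at h1
    obtain ⟨y, hy, hyb⟩ := h1
    have : algebraMap ℤ (𝓞 K) D * b = y := by
      apply RingOfIntegers.coe_injective
      have hyb' : (y : K) = Algebra.discr ℚ B.basis • (b : K) := hyb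
      refine Eq.trans ?_ hyb'.symm
      rw [← hD, Algebra.smul_def]
      simp
    rw [this]; exact hy
  rw [h0] at hmem
  exact hD0 (by simpa using hmem)

theorem absNorm_pair {K : Type*} [Field K] [NumberField K] (θ : 𝓞 K) (p : ℕ) (hp : p.Prime)
    (he : ¬ p ∣ RingOfIntegers.exponent θ) (z : ℤ) (hz : (p : ℤ) ∣ (minpoly ℤ θ).eval z) :
    Ideal.absNorm (Ideal.span {(p : 𝓞 K), θ - z}) = p := by
  have : Fact p.Prime := ⟨hp⟩
  have h0 : map (Int.castRingHom (ZMod p)) (minpoly ℤ θ) ≠ 0 :=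
      map_monic_ne_zero (minpoly.monic θ.isIntegral)
  have hmap : (X - C z : ℤ[X]).map (Int.castRingHom (ZMod p)) = X - C (z : ZMod p) := by simp
  have hQ : (X - C z : ℤ[X]).map (Int.castRingHom (ZMod p)) ∈
      RingOfIntegers.monicFactorsMod θ p := by
    rw [Multiset.mem_toFinset, Polynomial.mem_normalizedFactors_iff h0, hmap]
    refine ⟨irreducible_X_sub_C _, monic_X_sub_C _, ?_⟩
    rw [dvd_iff_isRoot, IsRoot, eval_map, ← eq_intCast (Int.castRingHom (ZMod p)) z, eval₂_at_apply]
    exact (ZMod.intCast_zmod_eq_zero_iff_dvd _ _).2 hz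
  have e := RingOfIntegers.ZModXQuotSpanEquivQuotSpanPair he hQ
  have h1 : aeval θ (X - C z : ℤ[X]) = θ - z := by simp
  rw [h1, hmap] at e
  have e2 := (Polynomial.quotientSpanXSubCAlgEquiv (z : ZMod p))
  rw [Ideal.absNorm_apply, Submodule.cardQuot_apply]
  have : Nat.card (𝓞 K ⧸ Ideal.span {(p : 𝓞 K), θ - z}) = Nat.card (ZMod p) :=
    Nat.card_congr (e.symm.toEquiv.trans e2.toEquiv)
  rw [Nat.card_zmod] at this
  exact this

theorem exists_int_sub_mem {K : Type*} [Field K] [NumberField K] (P : Ideal (𝓞 K)) (p : ℕ)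
    (hp : p.Prime) (h : Ideal.absNorm P = p) (x : 𝓞 K) : ∃ z : ℤ, x - z ∈ P := by
  have hcard : Nat.card (𝓞 K ⧸ P) = p := h
  have hx : AddSubgroup.zmultiples (1 : 𝓞 K ⧸ P) = ⊤ := by
    have : Fact p.Prime := ⟨hp⟩
    apply zmultiples_eq_top_of_prime_card hcard
    intro h1
    have : P = ⊤ := by
      rw [Ideal.eq_top_iff_one]
      exact Ideal.Quotient.eq_zero_iff_mem.1 h1
    rw [this, Ideal.absNorm_top] at h
    exact hp.one_lt.ne h
  have : Ideal.Quotient.mk P x ∈ AddSubgroup.zmultiples (1 : 𝓞 K ⧸ P) := by rw [hx]; trivial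
  obtain ⟨z, hz⟩ := AddSubgroup.mem_zmultiples_iff.1 this
  refine ⟨z, Ideal.Quotient.eq_zero_iff_mem.1 ?_⟩
  rw [map_sub, ← hz]; simp

theorem int_dvd_of_mem {K : Type*} [Field K] [NumberField K] (P : Ideal (𝓞 K)) (p : ℕ)
    (hp : p.Prime) (h : Ideal.absNorm P = p) (z : ℤ) (hz : (z : 𝓞 K) ∈ P) : (p : ℤ) ∣ z := by
  by_contra hn
  have hc : IsCoprime (p : ℤ) z := by
    rw [(Nat.prime_iff_prime_int.1 hp).coprime_iff_not_dvd]; exact hn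
  obtain ⟨a, b, hab⟩ := hc
  have hpm : (p : 𝓞 K) ∈ P := by rw [← h]; exact Ideal.absNorm_mem P
  have h1 : (1 : 𝓞 K) ∈ P := by
    have : (1 : 𝓞 K) = a * p + b * z := by exact_mod_cast (congrArg (Int.cast : ℤ → 𝓞 K) hab).symm
    rw [this]
    exact P.add_mem (P.mul_mem_left _ hpm) (P.mul_mem_left _ hz)
  rw [← Ideal.eq_top_iff_one] at h1
  rw [h1, Ideal.absNorm_top] at h
  exact hp.one_lt.ne h

theorem lemma3 (K : Type*) [Field K] [NumberField K] (θ : 𝓞 K)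
    (hgen : Algebra.adjoin ℚ {(θ : K)} = ⊤) (hdeg : 2 ≤ (minpoly ℤ θ).natDegree) (B : ℕ) :
    ∃ p : ℕ, p.Prime ∧ B < p ∧ ∀ z : ℤ, ¬ (p : ℤ) ∣ (minpoly ℤ θ).eval z := by
  classical
  by_contra hcon
  have hroot : ∀ p : ℕ, p.Prime → B < p → ∃ z : ℤ, (p : ℤ) ∣ (minpoly ℤ θ).eval z := by
    intro p hp hB
    by_contra h
    exact hcon ⟨p, hp, hB, fun z hz => h ⟨z, hz⟩⟩
  have hexp := exponent_ne_zero_aux θ hgen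
  set h := minpoly ℤ θ with hh
  have hmon : h.Monic := minpoly.monic θ.isIntegral
  set hq := h.map (algebraMap ℤ ℚ) with hhq
  have hmin : minpoly ℚ (θ : K) = hq :=
    minpoly.isIntegrallyClosed_eq_field_fractions ℚ K θ.isIntegral
  have hirr : Irreducible hq := by
    rw [← hmin]; exact minpoly.irreducible (θ.isIntegral_coe).tower_top
  let L := hq.SplittingField
  have : CharZero L := charZero_of_injective_algebraMap (algebraMap ℚ L).injective
  have : FiniteDimensional ℚ L := inferInstanceAs (FiniteDimensional ℚ hq.SplittingField)
  have : NumberField L := { }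
  have hcard : Fintype.card (hq.rootSet L) = hq.natDegree :=
    card_rootSet_eq_natDegree hirr.separable (SplittingField.splits hq)
  have hd2 : hq.natDegree = h.natDegree := hmon.natDegree_map _
  obtain ⟨⟨a, ha⟩, ⟨b, hb⟩, hab⟩ := Fintype.one_lt_card_iff.1
    (show 1 < Fintype.card (hq.rootSet L) by omega)
  have haev : ∀ x ∈ hq.rootSet L, aeval x h = 0 := by
    intro x hx
    have := (mem_rootSet.1 hx).2
    exact (aeval_map_algebraMap ℚ x h).symm.trans this
  have hIntg : ∀ x ∈ hq.rootSet L, IsIntegral ℤ x := fun x hx => ⟨h, hmon, haev x hx⟩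
  let α : 𝓞 L := ⟨a, hIntg a ha⟩
  let β : 𝓞 L := ⟨b, hIntg b hb⟩
  have hα : aeval α h = 0 := by
    apply RingOfIntegers.coe_injective
    rw [map_zero, ← aeval_algebraMap_apply]; exact haev a ha
  have hβ : aeval β h = 0 := by
    apply RingOfIntegers.coe_injective
    rw [map_zero, ← aeval_algebraMap_apply]; exact haev b hb
  have hne : α - β ≠ 0 := by
    intro h0
    apply hab
    have : α = β := sub_eq_zero.1 h0
    exact Subtype.ext (congrArg (fun x : 𝓞 L => (x : L)) this)
  set N0 := (Algebra.norm ℤ (α - β)).natAbs with hN0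
  have hN0' : N0 ≠ 0 := by
    rw [hN0, Int.natAbs_ne_zero, Algebra.norm_ne_zero_iff]; exact hne
  set B' := max B (max N0 (RingOfIntegers.exponent θ)) with hB'
  have hBB : B ≤ B' := le_max_left _ _
  have hBN : N0 ≤ B' := (le_max_left _ _).trans (le_max_right _ _)
  have hBe : RingOfIntegers.exponent θ ≤ B' := (le_max_right _ _).trans (le_max_right _ _)
  let S : Set ℕ := {p | p.Prime ∧ B' < p ∧ ∃ z₁ z₂ : ℤ, (p : ℤ) ∣ h.eval z₁ ∧ (p : ℤ) ∣ h.eval z₂ ∧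
    ¬ (p : ℤ) ∣ z₁ - z₂}
  have hred : ∀ (P : Ideal (𝓞 L)) (p : ℕ), p.Prime → Ideal.absNorm P = p → ∀ γ : 𝓞 L,
      aeval γ h = 0 → ∃ z : ℤ, (p : ℤ) ∣ h.eval z ∧ γ - z ∈ P := by
    intro P p hp hP γ hγ
    obtain ⟨z, hz⟩ := exists_int_sub_mem P p hp hP γ
    refine ⟨z, int_dvd_of_mem P p hp hP _ ?_, hz⟩
    have h1 := sub_dvd_eval_sub γ (z : 𝓞 L) (h.map (algebraMap ℤ (𝓞 L)))
    rw [eval_map_algebraMap, hγ, zero_sub, dvd_neg] at h1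
    have h2 : eval (z : 𝓞 L) (h.map (algebraMap ℤ (𝓞 L))) = ((h.eval z : ℤ) : 𝓞 L) := by
      rw [algebraMap_int_eq, eval_intCast_map]; simp
    rw [h2] at h1
    exact P.mem_of_dvd h1 hz
  refine lemma1 L B' S ?_ ?_
  · intro p hp hpB P hP
    obtain ⟨z₁, hz₁, hm₁⟩ := hred P p hp hP α hα
    obtain ⟨z₂, hz₂, hm₂⟩ := hred P p hp hP β hβ
    refine ⟨hp, hpB, z₁, z₂, hz₁, hz₂, fun hd => ?_⟩
    have hpm : (p : 𝓞 L) ∈ P := by rw [← hP]; exact Ideal.absNorm_mem P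
    have hzz : ((z₁ - z₂ : ℤ) : 𝓞 L) ∈ P := by
      obtain ⟨c, hc⟩ := hd
      rw [hc]; push_cast
      exact P.mul_mem_right _ hpm
    have hmem : α - β ∈ P := by
      have : α - β = (α - z₁) - (β - z₂) + ((z₁ - z₂ : ℤ) : 𝓞 L) := by push_cast; ring
      rw [this]
      exact P.add_mem (P.sub_mem hm₁ hm₂) hzz
    have h1 := Ideal.absNorm_dvd_norm_of_mem hmem
    rw [hP] at h1
    have h2 : p ∣ N0 := Int.natCast_dvd.1 h1
    have := Nat.le_of_dvd (Nat.pos_of_ne_zero hN0') h2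
    omega
  · have hz : ∀ p : ℕ, ∃ z : ℤ, p.Prime → B' < p → (p : ℤ) ∣ h.eval z := by
      intro p
      by_cases hp : p.Prime ∧ B' < p
      · obtain ⟨z, hz⟩ := hroot p hp.1 (by omega)
        exact ⟨z, fun _ _ => hz⟩
      · exact ⟨0, fun h1 h2 => absurd ⟨h1, h2⟩ hp⟩
    choose z hz using hz
    have hw : ∀ p : ℕ, ∃ w : ℤ, p ∈ S → (p : ℤ) ∣ h.eval w ∧ ¬ (p : ℤ) ∣ w - z p := by
      intro p
      by_cases hp : p ∈ S
      · obtain ⟨hp1, hpB, z₁, z₂, h₁, h₂, h₁₂⟩ := hp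
        by_cases hc : (p : ℤ) ∣ z₁ - z p
        · refine ⟨z₂, fun _ => ⟨h₂, fun hc2 => h₁₂ ?_⟩⟩
          have := dvd_sub hc hc2
          rwa [sub_sub_sub_cancel_right] at this
        · exact ⟨z₁, fun _ => ⟨h₁, hc⟩⟩
      · exact ⟨0, fun h => absurd h hp⟩
    choose w hw using hw
    have hexpd : ∀ p : ℕ, B' < p → ¬ p ∣ RingOfIntegers.exponent θ := by
      intro p hp hd
      have := Nat.le_of_dvd (Nat.pos_of_ne_zero hexp) hd
      omega
    refine lemma2 K B' (fun p => Ideal.span {(p : 𝓞 K), θ - z p})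
      (fun p => Ideal.span {(p : 𝓞 K), θ - w p}) S ?_ ?_
    · intro q hq hqB
      exact absNorm_pair θ q hq (hexpd q hqB) _ (hz q hq hqB)
    · intro p hp
      have hn := absNorm_pair θ p hp.1 (hexpd p hp.2.1) _ (hw p hp).1
      refine ⟨hp.1, hp.2.1, hn, fun heq => (hw p hp).2 ?_⟩
      apply int_dvd_of_mem _ p hp.1 hn
      have m1 : θ - w p ∈ Ideal.span {(p : 𝓞 K), θ - (w p : 𝓞 K)} :=
        Ideal.subset_span (by simp)
      have m2 : θ - z p ∈ Ideal.span {(p : 𝓞 K), θ - (w p : 𝓞 K)} := by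
        have heq' : Ideal.span {(p : 𝓞 K), θ - (w p : 𝓞 K)} =
          Ideal.span {(p : 𝓞 K), θ - (z p : 𝓞 K)} := heq
        rw [heq']
        exact Ideal.subset_span (by simp)
      have := Ideal.sub_mem _ m2 m1
      rw [sub_sub_sub_cancel_left] at this
      push_cast
      exact this

theorem exists_prime_values_aux (f : ℚ[X]) (hd : 2 ≤ f.natDegree)
    (K : Type*) [Field K] [NumberField K] (α : K) (htop : Algebra.adjoin ℚ {α} = ⊤)
    (hdv : ∀ g : ℚ[X], aeval α g = 0 → f ∣ g) :
    ∃ p : ℕ, p.Prime ∧ 2 < p ∧ ∀ x N : ℤ, f.eval (x : ℚ) = N → ¬ (p : ℤ) ∣ N := by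
  have halg : IsAlgebraic ℤ α := (IsFractionRing.isAlgebraic_iff ℤ ℚ K).2 (Algebra.IsAlgebraic.isAlgebraic α)
  obtain ⟨k, hk, hIntg⟩ := halg.exists_integral_multiple
  let θ : 𝓞 K := ⟨k • α, hIntg⟩
  have hθ : (θ : K) = (k : ℚ) • α := by
    change k • α = (k : ℚ) • α
    exact (Int.cast_smul_eq_zsmul ℚ k α).symm
  have hkq : (k : ℚ) ≠ 0 := by exact_mod_cast hk
  have hgen : Algebra.adjoin ℚ {(θ : K)} = ⊤ := by
    rw [eq_top_iff, ← htop, Algebra.adjoin_le_iff]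
    rintro x hx
    rw [Set.mem_singleton_iff] at hx
    have : x = (k : ℚ)⁻¹ • (θ : K) := by
      rw [hx, hθ, smul_smul, inv_mul_cancel₀ hkq, one_smul]
    rw [this]
    exact Subalgebra.smul_mem _ (Algebra.self_mem_adjoin_singleton ℚ _) _
  set h := minpoly ℤ θ with hh
  have hmon : h.Monic := minpoly.monic θ.isIntegral
  set hc := (h.map (algebraMap ℤ ℚ)).comp (C (k : ℚ) * X) with hhc
  have hdvd : f ∣ hc := by
    apply hdv
    rw [hhc, aeval_comp]
    have : aeval α (C (k : ℚ) * X) = (θ : K) := by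
      rw [hθ, map_mul, aeval_C, aeval_X, Algebra.smul_def]
    rw [this, aeval_map_algebraMap, aeval_algebraMap_apply, minpoly.aeval, map_zero]
  have hdc : hc.natDegree = h.natDegree := by
    rw [hhc, natDegree_comp, natDegree_C_mul_X _ hkq, mul_one, hmon.natDegree_map]
  have hc0 : hc ≠ 0 := by
    intro h0
    have h1 : 0 < h.natDegree := minpoly.natDegree_pos θ.isIntegral
    rw [← leadingCoeff_eq_zero, hhc, leadingCoeff_comp (by rw [natDegree_C_mul_X _ hkq]; norm_num),
      (hmon.map _).leadingCoeff] at h0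
    simp at h0
    exact hk h0.1
  have hdeg : 2 ≤ h.natDegree := by
    rw [← hdc]; exact hd.trans (natDegree_le_of_dvd hdvd hc0)
  obtain ⟨g, hg⟩ := hdvd
  obtain ⟨⟨D, hD⟩, hDg⟩ := IsLocalization.integerNormalization_map_to_map (nonZeroDivisors ℤ) g
  have hD0 : D ≠ 0 := nonZeroDivisors.ne_zero hD
  set G := IsLocalization.integerNormalization (nonZeroDivisors ℤ) g
  obtain ⟨p, hp, hpB, hpz⟩ := lemma3 K θ hgen hdeg (max D.natAbs 2)
  refine ⟨p, hp, lt_of_le_of_lt (le_max_right _ _) hpB, fun x N hxN hpN => hpz (k * x) ?_⟩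
  have e1 : ((h.eval (k * x) : ℤ) : ℚ) = hc.eval (x : ℚ) := by
    rw [hhc, eval_comp]
    simp only [eval_mul, eval_C, eval_X]
    rw [← Int.cast_mul, algebraMap_int_eq, eval_intCast_map]; simp
  have e2 : ((G.eval x : ℤ) : ℚ) = D * g.eval (x : ℚ) := by
    have := congrArg (eval (x : ℚ)) hDg
    rw [algebraMap_int_eq, eval_intCast_map] at this
    simpa using this
  have e3 : D * h.eval (k * x) = N * G.eval x := by
    have : ((D * h.eval (k * x) : ℤ) : ℚ) = ((N * G.eval x : ℤ) : ℚ) := by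
      rw [Int.cast_mul, Int.cast_mul, e1, e2, hg, eval_mul, hxN]; ring
    exact_mod_cast this
  have hdv : (p : ℤ) ∣ D * h.eval (k * x) := e3 ▸ hpN.mul_right _
  rcases (Nat.prime_iff_prime_int.1 hp).dvd_or_dvd hdv with h1 | h1
  · have := Nat.le_of_dvd (Int.natAbs_pos.2 hD0) (Int.natCast_dvd.1 h1)
    have := le_max_left D.natAbs 2
    omega
  · exact h1

theorem exists_prime_values_aux' (f : ℚ[X]) (hd : 2 ≤ f.natDegree)
    (K : Type*) [Field K] [NumberField K] [A : Algebra ℚ K] (α : K)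
    (htop : Algebra.adjoin ℚ {α} = ⊤)
    (hdv : ∀ g : ℚ[X], aeval α g = 0 → f ∣ g) :
    ∃ p : ℕ, p.Prime ∧ 2 < p ∧ ∀ x N : ℤ, f.eval (x : ℚ) = N → ¬ (p : ℤ) ∣ N := by
  obtain rfl : A = DivisionRing.toRatAlgebra := Subsingleton.elim _ _
  exact exists_prime_values_aux f hd K α htop hdv

theorem exists_prime_values (f : ℚ[X]) (hirr : Irreducible f) (hd : 2 ≤ f.natDegree) :
    ∃ p : ℕ, p.Prime ∧ 2 < p ∧ ∀ x N : ℤ, f.eval (x : ℚ) = N → ¬ (p : ℤ) ∣ N := by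
  have : Fact (Irreducible f) := ⟨hirr⟩
  have : CharZero (AdjoinRoot f) :=
    charZero_of_injective_algebraMap (algebraMap ℚ (AdjoinRoot f)).injective
  have hfd : FiniteDimensional ℚ (AdjoinRoot f) := (AdjoinRoot.powerBasis hirr.ne_zero).finite
  have : NumberField (AdjoinRoot f) := { to_finiteDimensional := by convert hfd }
  have htop := AdjoinRoot.adjoinRoot_eq_top (f := f)
  have hdv : ∀ g : ℚ[X], aeval (AdjoinRoot.root f) g = 0 → f ∣ g := by
    intro g hg
    rw [← AdjoinRoot.mk_eq_zero, ← AdjoinRoot.aeval_eq]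
    exact hg
  exact exists_prime_values_aux' f hd (AdjoinRoot f) (AdjoinRoot.root f) htop hdv

theorem dvd_doubleFactorial (a : ℕ) (ha : 0 < a) (t : ℕ) :
    a ∣ Nat.doubleFactorial (a + 2 * t) := by
  induction t with
  | zero =>
    obtain ⟨c, rfl⟩ : ∃ c, a = c + 1 := ⟨a - 1, by omega⟩
    rw [mul_zero, add_zero, Nat.doubleFactorial_add_one]
    exact dvd_mul_right _ _
  | succ t ih =>
    have : a + 2 * (t + 1) = (a + 2 * t) + 2 := by ring
    rw [this, Nat.doubleFactorial_add_two]
    exact ih.mul_left _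

theorem prime_dvd_doubleFactorial (p : ℕ) (hp : p.Prime) (h2 : 2 < p) (n : ℕ) (hn : 2 * p ≤ n) :
    p ∣ Nat.doubleFactorial n := by
  have hodd := hp.eq_two_or_odd
  rcases Nat.even_or_odd n with h | h
  · obtain ⟨c, hc⟩ := h
    have := dvd_doubleFactorial (2 * p) (by omega) (c - p)
    rw [show 2 * p + 2 * (c - p) = n by omega] at this
    exact (dvd_mul_left p 2).trans this
  · obtain ⟨c, hc⟩ := h
    have := dvd_doubleFactorial p hp.pos ((n - p) / 2)
    rwa [show p + 2 * ((n - p) / 2) = n by omega] at this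

/-- Let `r ≥ 1`, let `f(x) ∈ ℚ[x]` be an irreducible polynomial
of degree `d` with `d > r` and `d ≥ 2`, and let `b` be a nonzero integer. Then the
equation `b·n₁‼ ⋯ n_r‼ = f(x)` has only finitely many solutions `(n₁, …, n_r, x)`. -/
theorem stmt_12 (r : ℕ) (hr : 1 ≤ r) (f : Polynomial ℚ) (d : ℕ)
    (hdf : f.natDegree = d) (hdr : r < d) (hd : 2 ≤ d) (hirr : Irreducible f)
    (b : ℤ) (hb : b ≠ 0) :
    {q : (Fin r → ℕ) × ℤ |
      Polynomial.eval (q.2 : ℚ) f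
        = (b : ℚ) * ∏ i, (Nat.doubleFactorial (q.1 i) : ℚ)}.Finite := by
  obtain ⟨p, hp, hp2, hpf⟩ := exists_prime_values f hirr (hdf ▸ hd)
  have hfin : {n : Fin r → ℕ | ∀ i, n i ∈ Set.Iio (2 * p)}.Finite :=
    Set.Finite.pi' fun _ => Set.finite_Iio _
  have hx : ∀ c : ℚ, {x : ℤ | f.eval (x : ℚ) = c}.Finite := by
    intro c
    have hne : f - C c ≠ 0 := by
      intro h0
      have h1 : f = C c := sub_eq_zero.1 h0
      rw [h1, natDegree_C] at hdf
      omega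
    have h1 := (finite_setOf_isRoot hne).preimage (f := fun x : ℤ => (x : ℚ))
      Int.cast_injective.injOn
    refine h1.subset fun x hx => ?_
    have hx' : f.eval (x : ℚ) = c := hx
    simp [IsRoot, hx']
  refine (hfin.biUnion fun n _ => (hx ((b : ℚ) * ∏ i, (Nat.doubleFactorial (n i) : ℚ))).image
    fun x => (n, x)).subset ?_
  rintro ⟨n, x⟩ hq
  have hq' : f.eval (x : ℚ) = (b : ℚ) * ∏ i, (Nat.doubleFactorial (n i) : ℚ) := hq
  simp only [Set.mem_iUnion]
  refine ⟨n, ?_, x, hq', rfl⟩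
  intro i
  by_contra hi
  have hi' : 2 * p ≤ n i := by simpa using hi
  refine hpf x (b * ∏ i, (Nat.doubleFactorial (n i) : ℤ)) (by rw [hq']; push_cast; rfl) ?_
  refine Dvd.dvd.mul_left ?_ _
  refine dvd_trans ?_ (Finset.dvd_prod_of_mem _ (Finset.mem_univ i))
  exact_mod_cast prime_dvd_doubleFactorial p hp hp2 (n i) hi'
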